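/- Let G be a connected simple graph on a finite vertex set V with n = |V|, and suppose G has λ-locally bounded doubling dimension for a natural number λ ≥ 1. Then there exists a simple graph H on V (not necessarily a subgraph of G, i.e., a graph-metric spanner with auxiliary edges) such that H has at most (2 + λ⁴) · n edges and, for every pair u, v adjacent in G, u and v are reachable in H and d_H(u, v) ≤ 5. -/

import Mathlib

open Finset SimpleGraph Real

attribute [local instance] Classical.propDecidable

/-- `G` has `lam`-locally bounded doubling dimension: the 2-ball around any vertex is
covered by at most `lam` 1-balls. -/
def LocallyDoubling {V : Type} [Fintype V] [DecidableEq V]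
    (G : SimpleGraph V) (lam : ℕ) : Prop :=
  ∀ u : V, ∃ s : Finset V, s.card ≤ lam ∧
    ∀ w : V, G.dist u w ≤ 2 → ∃ y ∈ s, G.dist y w ≤ 1

/-- In a connected locally doubling graph, every ball of radius `r + 1` is covered by at most
`lam ^ r` balls of radius `1`. -/
theorem LocallyDoubling.exists_cover {V : Type} [Fintype V] [DecidableEq V]
    {G : SimpleGraph V} (hG : G.Connected) {lam : ℕ} (hdd : LocallyDoubling G lam)
    (u : V) (r : ℕ) :
    ∃ s : Finset V, s.card ≤ lam ^ r ∧ ∀ w, G.dist u w ≤ r + 1 → ∃ y ∈ s, G.dist y w ≤ 1 := by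
  induction r with
  | zero => exact ⟨{u}, by simp, fun w hw => ⟨u, by simp, by simpa using hw⟩⟩
  | succ r ih =>
    obtain ⟨s, hs, hcov⟩ := ih
    choose t ht htcov using hdd
    refine ⟨s.biUnion t, ?_, fun w hw => ?_⟩
    · calc (s.biUnion t).card ≤ s.card * lam := card_biUnion_le_card_mul _ _ _ fun a _ => ht a
        _ ≤ lam ^ r * lam := Nat.mul_le_mul_right _ hs
        _ = lam ^ (r + 1) := (pow_succ _ _).symm
    · have hstep : ∃ w', G.dist u w' ≤ r + 1 ∧ G.dist w' w ≤ 1 := by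
        obtain ⟨p, hp⟩ := hG.exists_walk_length_eq_dist u w
        refine ⟨p.getVert (r + 1), (dist_le (p.take (r + 1))).trans ?_,
          (dist_le (p.drop (r + 1))).trans ?_⟩
        · rw [Walk.take_length]; omega
        · rw [Walk.drop_length]; omega
      obtain ⟨w', hw', hw'w⟩ := hstep
      obtain ⟨y, hy, hyw'⟩ := hcov w' hw'
      have htri := hG.dist_triangle (u := y) (v := w') (w := w)
      obtain ⟨z, hz, hzw⟩ := htcov y w (by omega)
      exact ⟨z, mem_biUnion.2 ⟨y, hy, hz⟩, hzw⟩

/-- A finite set of vertices at pairwise distance at least `3` that is `2`-dense. -/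
theorem SimpleGraph.exists_separated_net {V : Type} [Fintype V] (G : SimpleGraph V) :
    ∃ S : Finset V, (∀ a ∈ S, ∀ b ∈ S, G.dist a b ≤ 2 → a = b) ∧
      ∀ v, ∃ a ∈ S, G.dist v a ≤ 2 := by
  obtain ⟨S, hS, hmax⟩ := exists_max_image
    (univ.filter fun S : Finset V => ∀ a ∈ S, ∀ b ∈ S, G.dist a b ≤ 2 → a = b) card
    ⟨∅, by simp⟩
  simp only [mem_filter, mem_univ, true_and] at hS hmax
  refine ⟨S, hS, fun v => ?_⟩
  by_contra! hv
  have hvS : v ∉ S := fun h => by simpa using hv v h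
  have hle := hmax (insert v S) ?_
  · rw [card_insert_of_notMem hvS] at hle
    omega
  · intro a ha b hb hab
    rcases mem_insert.1 ha with rfl | ha' <;> rcases mem_insert.1 hb with rfl | hb'
    · rfl
    · exact absurd hab (hv b hb').not_ge
    · exact absurd (dist_comm (G := G) ▸ hab) (hv a ha').not_ge
    · exact hS a ha' b hb' hab

/-- A relation with at most `k` successors per vertex generates a graph with at most `k * |V|`
edges. -/
theorem SimpleGraph.card_edgeFinset_fromRel_le {V : Type} [Fintype V] (R : V → V → Prop) (k : ℕ)
    (hR : ∀ a, (univ.filter (R a)).card ≤ k) {_ : Fintype (SimpleGraph.fromRel R).edgeSet} :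
    (SimpleGraph.fromRel R).edgeFinset.card ≤ k * Fintype.card V := by
  have hsub : (SimpleGraph.fromRel R).edgeFinset ⊆
      univ.biUnion fun a => (univ.filter (R a)).image fun b => s(a, b) := by
    intro e
    induction e with
    | h a b =>
      simp only [mem_edgeFinset, mem_edgeSet, fromRel_adj, mem_biUnion, mem_univ, true_and,
        mem_image, mem_filter]
      rintro ⟨-, h | h⟩
      · exact ⟨a, b, h, rfl⟩
      · exact ⟨b, a, h, Sym2.eq_swap⟩
  calc _ ≤ _ := card_le_card hsub
    _ ≤ (univ : Finset V).card * k :=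
      card_biUnion_le_card_mul _ _ _ fun a _ => card_image_le.trans (hR a)
    _ = k * Fintype.card V := by rw [card_univ, mul_comm]

theorem SimpleGraph.exists_walk_length_le_one_of_fromRel {V : Type} {R : V → V → Prop} {a b : V}
    (h : R a b ∨ R b a) : ∃ p : (SimpleGraph.fromRel R).Walk a b, p.length ≤ 1 := by
  by_cases hab : a = b
  · subst hab
    exact ⟨.nil, by simp⟩
  · exact ⟨(((fromRel_adj R a b).2 ⟨hab, h⟩)).toWalk, by simp⟩

theorem stmt_12 {V : Type} [Fintype V] [DecidableEq V]
    (G : SimpleGraph V) (hG : G.Connected)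
    (lam : ℕ) (hlam : 1 ≤ lam) (hdd : LocallyDoubling G lam) :
    ∃ H : SimpleGraph V,
      H.edgeFinset.card ≤ (2 + lam ^ 4) * Fintype.card V ∧
      ∀ u v, G.Adj u v → H.Reachable u v ∧ H.dist u v ≤ 5 := by
  obtain ⟨S, hsep, hnet⟩ := G.exists_separated_net
  choose c hcS hc using hnet
  let R : V → V → Prop := fun a b => b = c a ∨ (b ∈ S ∧ G.dist a b ≤ 5)
  refine ⟨SimpleGraph.fromRel R, ?_, fun u v huv => ?_⟩
  · apply card_edgeFinset_fromRel_le
    intro a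
    obtain ⟨s, hs, hcov⟩ := hdd.exists_cover hG a 4
    have hnear : (univ.filter fun b => b ∈ S ∧ G.dist a b ≤ 5).card ≤ s.card := by
      have hcov' : ∀ b : V, ∃ y, G.dist a b ≤ 5 → y ∈ s ∧ G.dist y b ≤ 1 := fun b => by
        by_cases hb : G.dist a b ≤ 5
        · obtain ⟨y, hy⟩ := hcov b hb
          exact ⟨y, fun _ => hy⟩
        · exact ⟨b, fun h => absurd h hb⟩
      choose f hf using hcov'
      refine card_le_card_of_injOn f (fun b hb => ?_) fun b hb b' hb' hbb' => ?_
      · exact (hf b (by simpa using (mem_filter.1 hb).2.2)).1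
      · have hb := (mem_filter.1 hb).2
        have hb' := (mem_filter.1 hb').2
        have h1 := (hf b hb.2).2
        have h2 := (hf b' hb'.2).2
        have htri := hG.dist_triangle (u := b) (v := f b) (w := b')
        rw [dist_comm (u := b) (v := f b)] at htri
        rw [← hbb'] at h2
        exact hsep b hb.1 b' hb'.1 (by omega)
    refine (card_le_card (t := insert (c a) (univ.filter fun b => b ∈ S ∧ G.dist a b ≤ 5))
      fun b hb => ?_).trans ((card_insert_le _ _).trans (by omega))
    simpa [R] using hb
  · have hcc : G.dist (c u) (c v) ≤ 5 := by
      have h1 := hG.dist_triangle (u := c u) (v := u) (w := c v)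
      have h2 := hG.dist_triangle (u := u) (v := v) (w := c v)
      rw [dist_comm (u := c u) (v := u)] at h1
      have := dist_eq_one_iff_adj.2 huv
      have := hc u
      have := hc v
      omega
    obtain ⟨p, hp⟩ := exists_walk_length_le_one_of_fromRel (R := R) (a := u) (b := c u)
      (.inl (.inl rfl))
    obtain ⟨q, hq⟩ := exists_walk_length_le_one_of_fromRel (R := R) (a := c u) (b := c v)
      (.inl (.inr ⟨hcS v, hcc⟩))
    obtain ⟨r, hr⟩ := exists_walk_length_le_one_of_fromRel (R := R) (a := c v) (b := v)
      (.inr (.inl rfl))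
    refine ⟨(p.append (q.append r)).reachable, (dist_le (p.append (q.append r))).trans ?_⟩
    simp only [Walk.length_append]
    omega
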